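/- Fano's inequality: Let X be a random variable uniformly distributed over a finite set 𝒳 with |𝒳| ≥ 2, and let X̂ be any estimator taking values in 𝒳 such that X → Y → X̂ forms a Markov chain (X̂ is conditionally independent of X given Y, all random variables taking values in finite sets). Then Pr(X̂ ≠ X) ≥ 1 − (I(X; X̂) + log 2)/log|𝒳|. -/

import Mathlib

open Finset

open scoped Classical

/-- Probability of an event `E` under a probability mass function `p` on a finite sample
space `Ω`. -/
noncomputable def pr {Ω : Type*} [Fintype Ω] (p : Ω → ℝ) (E : Ω → Prop) : ℝ :=
  ∑ ω, if E ω then p ω else 0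

/-- Mutual information `I(X;Y)` of two discrete random variables (natural logarithm,
with the convention `0 · log 0 = 0`, which holds automatically since `0 * log 0 = 0`). -/
noncomputable def mutualInfo {Ω 𝒳 𝒴 : Type*} [Fintype Ω] [Fintype 𝒳] [Fintype 𝒴]
    (p : Ω → ℝ) (X : Ω → 𝒳) (Y : Ω → 𝒴) : ℝ :=
  ∑ x : 𝒳, ∑ y : 𝒴,
    pr p (fun ω => X ω = x ∧ Y ω = y) *
      Real.log (pr p (fun ω => X ω = x ∧ Y ω = y) /
        (pr p (fun ω => X ω = x) * pr p (fun ω => Y ω = y)))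

/-- `X → Y → Z` is a Markov chain: `X` and `Z` are conditionally independent given `Y`. -/
def MarkovChain {Ω 𝒳 𝒴 𝒵 : Type*} [Fintype Ω]
    (p : Ω → ℝ) (X : Ω → 𝒳) (Y : Ω → 𝒴) (Z : Ω → 𝒵) : Prop :=
  ∀ (x : 𝒳) (y : 𝒴) (z : 𝒵),
    pr p (fun ω => X ω = x ∧ Y ω = y ∧ Z ω = z) * pr p (fun ω => Y ω = y)
      = pr p (fun ω => X ω = x ∧ Y ω = y) * pr p (fun ω => Y ω = y ∧ Z ω = z)

theorem pr_nonneg {Ω : Type*} [Fintype Ω] {p : Ω → ℝ} (hp : ∀ ω, 0 ≤ p ω) (E : Ω → Prop) :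
    0 ≤ pr p E :=
  Finset.sum_nonneg fun ω _ => by split_ifs <;> simp [hp ω]

theorem pr_mono {Ω : Type*} [Fintype Ω] {p : Ω → ℝ} (hp : ∀ ω, 0 ≤ p ω) {E F : Ω → Prop}
    (h : ∀ ω, E ω → F ω) : pr p E ≤ pr p F := by
  refine Finset.sum_le_sum fun ω _ => ?_
  by_cases hE : E ω
  · simp [hE, h ω hE]
  · simp only [hE, if_false]
    split_ifs <;> simp [hp ω]

theorem sum_pr_and_eq {Ω α : Type*} [Fintype Ω] [Fintype α] (p : Ω → ℝ) (E : Ω → Prop)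
    (Z : Ω → α) : ∑ a, pr p (fun ω => E ω ∧ Z ω = a) = pr p E := by
  unfold pr
  rw [Finset.sum_comm]
  refine Finset.sum_congr rfl fun ω _ => ?_
  by_cases hE : E ω <;> simp [hE]

theorem sum_pr_eq {Ω α : Type*} [Fintype Ω] [Fintype α] (p : Ω → ℝ) (Z : Ω → α) :
    ∑ a, pr p (fun ω => Z ω = a) = ∑ ω, p ω := by
  simpa [pr] using sum_pr_and_eq p (fun _ => True) Z

theorem sum_pr_diag {Ω α : Type*} [Fintype Ω] [Fintype α] (p : Ω → ℝ) (X Z : Ω → α) :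
    ∑ a, pr p (fun ω => X ω = a ∧ Z ω = a) = ∑ ω, p ω - pr p (fun ω => Z ω ≠ X ω) := by
  unfold pr
  rw [Finset.sum_comm, ← Finset.sum_sub_distrib]
  refine Finset.sum_congr rfl fun ω _ => ?_
  by_cases h : Z ω = X ω
  · simp [h]
  · have h' : ∀ a, ¬ (X ω = a ∧ Z ω = a) := fun a ha => h (ha.2.trans ha.1.symm)
    simp [h, h']

/-- The tangent-line bound for `q * log (q / r)` at slope parameter `c`. -/
theorem mul_log_add_sub_le_mul_log_div {q r c : ℝ} (hq : 0 ≤ q) (hr : 0 ≤ r) (hc : 0 < c)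
    (hqr : r = 0 → q = 0) : q * Real.log c + q - c * r ≤ q * Real.log (q / r) := by
  rcases hq.eq_or_lt with rfl | hq
  · simpa using mul_nonneg hc.le hr
  have hr : 0 < r := hr.lt_of_ne fun h => hq.ne' (hqr h.symm)
  have h := Real.log_le_sub_one_of_pos (show 0 < c * r / q by positivity)
  rw [Real.log_div (by positivity) hq.ne', Real.log_mul hc.ne' hr.ne'] at h
  rw [Real.log_div hq.ne' hr.ne']
  have h' := mul_le_mul_of_nonneg_left h hq.le
  have hcancel : q * (c * r / q - 1) = c * r - q := by field_simp
  linarith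

/-- **Fano's inequality.** If `X` is uniformly distributed over a finite set `𝒳` with
`|𝒳| ≥ 2` and `X → Y → X̂` is a Markov chain, then
`Pr(X̂ ≠ X) ≥ 1 − (I(X;X̂) + log 2)/log |𝒳|`. -/
theorem fano_inequality {Ω 𝒳 𝒴 : Type*} [Fintype Ω] [Fintype 𝒳] [Fintype 𝒴]
    (p : Ω → ℝ) (hp0 : ∀ ω, 0 ≤ p ω) (hp1 : ∑ ω, p ω = 1)
    (X : Ω → 𝒳) (Y : Ω → 𝒴) (Xhat : Ω → 𝒳)
    (hcard : 2 ≤ Fintype.card 𝒳)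
    (hunif : ∀ x : 𝒳, pr p (fun ω => X ω = x) = 1 / (Fintype.card 𝒳 : ℝ))
    (hmarkov : MarkovChain p X Y Xhat) :
    pr p (fun ω => Xhat ω ≠ X ω) ≥
      1 - (mutualInfo p X Xhat + Real.log 2) / Real.log (Fintype.card 𝒳) := by
  set M : ℝ := (Fintype.card 𝒳 : ℝ) with hM
  have hM2 : (2 : ℝ) ≤ M := by rw [hM]; exact_mod_cast hcard
  have hM0 : 0 < M := by linarith
  have hlogM : 0 < Real.log M := Real.log_pos (by linarith)
  have hterm : ∀ x y : 𝒳,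
      (if x = y then pr p (fun ω => X ω = x ∧ Xhat ω = y) * Real.log M
        - pr p (fun ω => Xhat ω = y) / 2 else 0)
        + (pr p (fun ω => X ω = x ∧ Xhat ω = y) * (1 - Real.log 2)
          - pr p (fun ω => Xhat ω = y) / (2 * M)) ≤
      pr p (fun ω => X ω = x ∧ Xhat ω = y) *
        Real.log (pr p (fun ω => X ω = x ∧ Xhat ω = y) /
          (pr p (fun ω => X ω = x) * pr p (fun ω => Xhat ω = y))) := by
    intro x y
    rw [hunif x]
    have hq := pr_nonneg hp0 (fun ω => X ω = x ∧ Xhat ω = y)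
    have hb := pr_nonneg hp0 (fun ω => Xhat ω = y)
    have hqb : pr p (fun ω => X ω = x ∧ Xhat ω = y) ≤ pr p (fun ω => Xhat ω = y) :=
      pr_mono hp0 fun _ h => h.2
    generalize pr p (fun ω => X ω = x ∧ Xhat ω = y) = q at *
    generalize pr p (fun ω => Xhat ω = y) = b at *
    have hr : 0 ≤ 1 / M * b := by positivity
    have hqr : 1 / M * b = 0 → q = 0 := fun h => by
      have : b = 0 := (mul_eq_zero.mp h).resolve_left (by positivity)
      linarith
    have hbM : 0 ≤ b / (2 * M) := by positivity
    split_ifs with hxy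
    · have h := mul_log_add_sub_le_mul_log_div hq hr (show 0 < M / 2 by positivity) hqr
      rw [Real.log_div hM0.ne' two_ne_zero] at h
      have hcr : M / 2 * (1 / M * b) = b / 2 := by field_simp
      linarith
    · have h := mul_log_add_sub_le_mul_log_div hq hr (show (0 : ℝ) < 1 / 2 by norm_num) hqr
      rw [Real.log_div one_ne_zero two_ne_zero, Real.log_one] at h
      have hcr : 1 / 2 * (1 / M * b) = b / (2 * M) := by field_simp
      linarith
  have hsum := Finset.sum_le_sum fun x (_ : x ∈ Finset.univ) =>
    Finset.sum_le_sum fun y (_ : y ∈ Finset.univ) => hterm x y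
  have hjoint : ∑ x, ∑ y, pr p (fun ω => X ω = x ∧ Xhat ω = y) = 1 := by
    simp_rw [sum_pr_and_eq, sum_pr_eq, hp1]
  have hhat : ∑ y, pr p (fun ω => Xhat ω = y) = 1 := by rw [sum_pr_eq, hp1]
  have hdiag := sum_pr_diag p X Xhat
  have hbound : (1 - pr p (fun ω => Xhat ω ≠ X ω)) * Real.log M - Real.log 2 ≤
      mutualInfo p X Xhat := by
    refine le_trans (le_of_eq ?_) hsum
    simp only [Finset.sum_add_distrib, Finset.sum_sub_distrib, Finset.sum_ite_eq,
      Finset.mem_univ, if_true, ← Finset.sum_mul, ← Finset.sum_div, hjoint, hhat, hdiag, hp1,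
      Finset.sum_const, Finset.card_univ, nsmul_eq_mul, ← hM]
    field_simp
    ring
  have hdiv : 1 - pr p (fun ω => Xhat ω ≠ X ω) ≤
      (mutualInfo p X Xhat + Real.log 2) / Real.log M := by
    rw [le_div_iff₀ hlogM]
    linarith
  linarith
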